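/- arXiv:2008.07526 — 2 statements merged into one kernel-verified Lean document; each statement's English description precedes it below -/
import Mathlib

section
/- Let 0 < p < 1/2 and let Φ : ℕ_{+} → [1, ∞) be any non-decreasing function satisfying Φ(n) ↑ ∞ and limsup_{k→∞} 2^{k(2−2p)} / Φ(2^k) = ∞. Then there exists a martingale F ∈ H_p(G) such that Σ_{m=1}^{∞} ‖σ_m^κ F‖_{L_{p,∞}}^{p} / Φ(m) = ∞. -/
open MeasureTheory Filter
open scoped ENNReal

noncomputable section

namespace WalshKaczmarz

/-- The Walsh group `G`: sequences of elements of `ZMod 2` with coordinatewise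
addition modulo 2. -/
abbrev G : Type := ℕ → ZMod 2

instance : MeasurableSpace (ZMod 2) := ⊤

/-- The normalized Haar (product) measure on `G`, realized as the pushforward of
Lebesgue measure on `[0,1)` under the binary digit expansion map. Each coordinate
is uniformly distributed on `ZMod 2` and coordinates are independent.  -/
def μG : Measure G :=
  Measure.map (fun t : ℝ => fun k : ℕ => ((⌊t * 2 ^ (k + 1)⌋ : ℤ) : ZMod 2))
    (volume.restrict (Set.Ico (0 : ℝ) 1))

/-- The dyadic interval `I_n(x)`. -/
def I (n : ℕ) (x : G) : Set G := {y : G | ∀ k < n, y k = x k}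

/-- `e n` : the element of `G` whose `n`-th coordinate is `1` and all others `0`. -/
def e (n : ℕ) : G := fun k => if k = n then 1 else 0

/-- The `k`-th Rademacher function `r_k(x) = (-1)^{x_k}`. -/
def rademacher (k : ℕ) (x : G) : ℝ := (-1 : ℝ) ^ (x k).val

/-- `|n| = max {j : n_j ≠ 0}`, the order of `n ≥ 1`. -/
def order (n : ℕ) : ℕ := Nat.log 2 n

/-- The Walsh–Paley function `w_n = ∏_k r_k^{n_k}`. -/
def walsh (n : ℕ) (x : G) : ℝ :=
  ∏ k ∈ Finset.range n, (if n.testBit k then rademacher k x else 1)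

/-- The Walsh–Kaczmarz function `κ_n`. -/
def kacz (n : ℕ) (x : G) : ℝ :=
  if n = 0 then 1 else
    rademacher (order n) x *
      (-1 : ℝ) ^ (∑ k ∈ Finset.range (order n),
        (if n.testBit k then (x (order n - 1 - k)).val else 0))

/-- Skvortsov's coordinate transformation `τ_A`. -/
def tau (A : ℕ) (x : G) : G := fun k => if k < A then x (A - 1 - k) else x k

/-- The Walsh–Paley Dirichlet kernel `D_n^w`. -/
def dirW (n : ℕ) (x : G) : ℝ := ∑ k ∈ Finset.range n, walsh k x

/-- The Walsh–Kaczmarz Dirichlet kernel `D_n^κ`. -/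
def dirK (n : ℕ) (x : G) : ℝ := ∑ k ∈ Finset.range n, kacz k x

/-- The Walsh–Paley Fejér kernel `K_n^w = (1/n) ∑_{k=0}^n D_k^w`. -/
def fejW (n : ℕ) (x : G) : ℝ := (1 / (n : ℝ)) * ∑ k ∈ Finset.range (n + 1), dirW k x

/-- The Walsh–Kaczmarz Fejér kernel `K_n^κ = (1/n) ∑_{k=0}^n D_k^κ`. -/
def fejK (n : ℕ) (x : G) : ℝ := (1 / (n : ℝ)) * ∑ k ∈ Finset.range (n + 1), dirK k x

/-- The Walsh–Kaczmarz–Fourier coefficient of an integrable function. -/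
def coeffK (f : G → ℝ) (k : ℕ) : ℝ := ∫ x, f x * kacz k x ∂μG

/-- The `n`-th Walsh–Kaczmarz partial sum `S_n^κ f`. -/
def SK (f : G → ℝ) (n : ℕ) (x : G) : ℝ := ∑ k ∈ Finset.range n, coeffK f k * kacz k x

/-- The `n`-th Walsh–Kaczmarz Fejér mean `σ_n^κ f = (1/n) ∑_{j=0}^n S_j^κ f`. -/
def sigmaK (f : G → ℝ) (n : ℕ) (x : G) : ℝ :=
  (1 / (n : ℝ)) * ∑ j ∈ Finset.range (n + 1), SK f j x

/-- `𝔉_n` : the σ-algebra generated by the dyadic intervals of measure `2^{-n}`. -/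
def F (n : ℕ) : MeasurableSpace G := MeasurableSpace.generateFrom {s | ∃ x : G, s = I n x}

/-- A martingale with respect to the filtration `(𝔉_n)` of dyadic σ-algebras. -/
def IsDyadicMartingale (f : ℕ → G → ℝ) : Prop :=
  (∀ n, Integrable (f n) μG) ∧ (∀ n, StronglyMeasurable[F n] (f n)) ∧
    ∀ n, μG[f (n + 1)|F n] =ᵐ[μG] f n

/-- `‖f‖_{H_p}^p = ∫ (f^*)^p dμ` for a martingale `f`, where `f^* = sup_n |f^{(n)}|`
is the maximal function. -/
def martHpNormP (p : ℝ) (f : ℕ → G → ℝ) : ℝ≥0∞ :=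
  ∫⁻ x, (⨆ n, ENNReal.ofReal |f n x|) ^ p ∂μG

/-- The martingale Hardy norm `‖f‖_{H_p} = ‖f^*‖_{L_p}`. -/
def martHpNorm (p : ℝ) (f : ℕ → G → ℝ) : ℝ≥0∞ := martHpNormP p f ^ (1 / p)

/-- Membership in the martingale Hardy space `H_p(G)`. -/
def MemHp (p : ℝ) (f : ℕ → G → ℝ) : Prop :=
  IsDyadicMartingale f ∧ martHpNormP p f < ∞

/-- The maximal function of an integrable function `g`, i.e. of the martingale
`(S_{2^n} g)`:  `g^*(x) = sup_n (1/μ(I_n(x))) |∫_{I_n(x)} g dμ|`. -/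
def funMaximal (g : G → ℝ) (x : G) : ℝ≥0∞ :=
  ⨆ n : ℕ, ENNReal.ofReal |∫ u in I n x, g u ∂μG| / μG (I n x)

/-- `‖g‖_{H_p}^p` for a function `g`, identified with the martingale `(S_{2^n} g)`. -/
def funHpNormP (p : ℝ) (g : G → ℝ) : ℝ≥0∞ := ∫⁻ x, funMaximal g x ^ p ∂μG

/-- `‖g‖_{L_p}^p = ∫ |g|^p dμ`. -/
def funLpNormP (p : ℝ) (g : G → ℝ) : ℝ≥0∞ := ∫⁻ x, ENNReal.ofReal |g x| ^ p ∂μG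

/-- The weak `L_p` quasinorm `‖g‖_{L_{p,∞}} = sup_{λ>0} λ μ({|g|>λ})^{1/p}`. -/
def weakLpNorm (p : ℝ) (g : G → ℝ) : ℝ≥0∞ :=
  ⨆ (t : ℝ) (_ : 0 < t), ENNReal.ofReal t * μG {x : G | t < |g x|} ^ (1 / p)

/-- The Walsh–Kaczmarz–Fourier coefficient of a martingale:
`f̂(i) = lim_k ∫ f^{(k)} κ_i dμ`. -/
def martCoeffK (f : ℕ → G → ℝ) (i : ℕ) : ℝ :=
  limUnder atTop (fun k => ∫ x, f k x * kacz i x ∂μG)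

/-- The `n`-th Walsh–Kaczmarz partial sum of a martingale. -/
def martSK (f : ℕ → G → ℝ) (n : ℕ) (x : G) : ℝ :=
  ∑ k ∈ Finset.range n, martCoeffK f k * kacz k x

/-- The `n`-th Walsh–Kaczmarz Fejér mean of a martingale. -/
def martSigmaK (f : ℕ → G → ℝ) (n : ℕ) (x : G) : ℝ :=
  (1 / (n : ℝ)) * ∑ j ∈ Finset.range (n + 1), martSK f j x

/-- A `p`-atom supported on the dyadic interval `I_n(x₀)`. -/
def IsPAtomOn (p : ℝ) (n : ℕ) (x₀ : G) (a : G → ℝ) : Prop :=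
  Measurable a ∧ (∀ y, y ∉ I n x₀ → a y = 0) ∧ (∫ y in I n x₀, a y ∂μG) = 0 ∧
    ∀ y, ENNReal.ofReal |a y| ≤ μG (I n x₀) ^ (-(1 / p))

/-- A `p`-atom. -/
def IsPAtom (p : ℝ) (a : G → ℝ) : Prop := ∃ n x₀, IsPAtomOn p n x₀ a

end WalshKaczmarz
namespace WalshKaczmarz

lemma measurable_digits :
    Measurable (fun t : ℝ => fun k : ℕ => ((⌊t * 2 ^ (k + 1)⌋ : ℤ) : ZMod 2)) := by
  refine measurable_pi_lambda _ fun k => ?_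
  have h : Measurable (fun z : ℤ => (z : ZMod 2)) := measurable_from_top
  exact h.comp (Int.measurable_floor.comp (measurable_id.mul_const _))

instance : IsProbabilityMeasure μG := by
  have : IsProbabilityMeasure (volume.restrict (Set.Ico (0 : ℝ) 1)) := ⟨by simp⟩
  exact Measure.isProbabilityMeasure_map measurable_digits.aemeasurable

/-- A set that is a union of dyadic intervals of rank `n` is `𝔉_n`-measurable. -/
lemma measurableSet_of_saturated {n : ℕ} {s : Set G} (hs : ∀ x ∈ s, I n x ⊆ s) :
    MeasurableSet[F n] s := by
  classical
  let ext : (Fin n → ZMod 2) → G := fun z k => if h : k < n then z ⟨k, h⟩ else 0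
  have hrepr : s = ⋃ z ∈ {z : Fin n → ZMod 2 | ext z ∈ s}, I n (ext z) := by
    ext x
    simp only [Set.mem_iUnion, Set.mem_ofPred_eq, exists_prop]
    constructor
    · intro hx
      have hmem : ∀ k < n, ext (fun i => x i) k = x k := fun k hk => by simp [ext, hk]
      exact ⟨fun i => x i, hs x hx hmem, fun k hk => (hmem k hk).symm⟩
    · rintro ⟨z, hz, hx⟩
      exact hs _ hz hx
  rw [hrepr]
  exact MeasurableSet.biUnion (Set.to_countable _)
    fun z _ => MeasurableSpace.measurableSet_generateFrom ⟨_, rfl⟩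

lemma measurableSet_eval_eq (k : ℕ) (a : ZMod 2) : MeasurableSet {x : G | x k = a} :=
  have ha : MeasurableSet ({a} : Set (ZMod 2)) := trivial
  measurable_pi_apply (X := fun _ : ℕ => ZMod 2) k ha

lemma measurableSet_I (n : ℕ) (x : G) : MeasurableSet (I n x) := by
  have h : I n x = ⋂ k ∈ Set.Iio n, {y : G | y k = x k} := by
    ext y; simp [I]
  rw [h]
  exact MeasurableSet.biInter (Set.to_countable _) fun k _ => measurableSet_eval_eq k _

lemma F_le (n : ℕ) : F n ≤ (inferInstance : MeasurableSpace G) := by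
  refine MeasurableSpace.generateFrom_le ?_
  rintro _ ⟨x, rfl⟩
  exact measurableSet_I n x

lemma exists_digits_preimage_I (n : ℕ) (x : G) : ∃ j : ℕ,
    {t : ℝ | t ∈ Set.Ico (0 : ℝ) 1 ∧ ∀ k < n, ((⌊t * 2 ^ (k + 1)⌋ : ℤ) : ZMod 2) = x k} =
      Set.Ico ((j : ℝ) / 2 ^ n) ((j + 1) / 2 ^ n) := by
  induction n with
  | zero => exact ⟨0, by ext t; simp⟩
  | succ n ih =>
    obtain ⟨j, hset⟩ := ih
    have hval : (x n).val < 2 := ZMod.val_lt _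
    refine ⟨2 * j + (x n).val, ?_⟩
    have hsplit : {t : ℝ | t ∈ Set.Ico (0 : ℝ) 1 ∧
        ∀ k < n + 1, ((⌊t * 2 ^ (k + 1)⌋ : ℤ) : ZMod 2) = x k} =
        Set.Ico ((j : ℝ) / 2 ^ n) ((j + 1) / 2 ^ n) ∩
          {t : ℝ | ((⌊t * 2 ^ (n + 1)⌋ : ℤ) : ZMod 2) = x n} := by
      rw [← hset]
      ext t
      simp only [Set.mem_ofPred_eq, Set.mem_inter_iff, and_assoc, Nat.forall_lt_succ_right]
    rw [hsplit]
    ext t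
    have hpos : (0 : ℝ) < 2 ^ n := by positivity
    have hpos' : (0 : ℝ) < 2 ^ (n + 1) := by positivity
    simp only [Set.mem_inter_iff, Set.mem_Ico, Set.mem_ofPred_eq, div_le_iff₀ hpos,
      lt_div_iff₀ hpos, div_le_iff₀ hpos', lt_div_iff₀ hpos']
    have hfl : ((2 * j + (x n).val : ℕ) : ℝ) ≤ t * 2 ^ (n + 1) ∧
        t * 2 ^ (n + 1) < ((2 * j + (x n).val : ℕ) : ℝ) + 1 ↔
        ⌊t * 2 ^ (n + 1)⌋ = ((2 * j + (x n).val : ℕ) : ℤ) := by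
      rw [Int.floor_eq_iff]; push_cast; rfl
    have hfl' : (j : ℝ) ≤ t * 2 ^ n ∧ t * 2 ^ n < (j : ℝ) + 1 ↔
        2 * (j : ℤ) ≤ ⌊t * 2 ^ (n + 1)⌋ ∧ ⌊t * 2 ^ (n + 1)⌋ < 2 * (j : ℤ) + 2 := by
      rw [Int.le_floor, Int.floor_lt, pow_succ]
      push_cast
      constructor <;> rintro ⟨h1, h2⟩ <;> constructor <;> linarith
    rw [hfl, hfl']
    generalize ⌊t * 2 ^ (n + 1)⌋ = z
    have hx : x n = (((x n).val : ℤ) : ZMod 2) := by simp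
    generalize (x n).val = v at *
    rw [hx, ZMod.intCast_eq_intCast_iff_dvd_sub]
    push_cast
    omega

lemma measure_I (n : ℕ) (x : G) : μG (I n x) = (2⁻¹ : ℝ≥0∞) ^ n := by
  obtain ⟨j, hset⟩ := exists_digits_preimage_I n x
  rw [μG, Measure.map_apply measurable_digits (measurableSet_I n x),
    Measure.restrict_apply (measurable_digits (measurableSet_I n x))]
  have h : (fun t : ℝ => fun k : ℕ => ((⌊t * 2 ^ (k + 1)⌋ : ℤ) : ZMod 2)) ⁻¹' I n x ∩
      Set.Ico (0 : ℝ) 1 = Set.Ico ((j : ℝ) / 2 ^ n) ((j + 1) / 2 ^ n) := by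
    rw [← hset]
    ext t
    simp only [I, Set.mem_inter_iff, Set.mem_preimage, Set.mem_ofPred_eq]
    exact and_comm
  rw [h, Real.volume_Ico, ← sub_div, add_sub_cancel_left, one_div,
    ENNReal.ofReal_inv_of_pos (by positivity), ENNReal.ofReal_pow (by norm_num),
    ENNReal.ofReal_ofNat, ENNReal.inv_pow]

/-- The family of all dyadic intervals. -/
def dyadicIntervals : Set (Set G) := {s | ∃ n x, s = I n x}

lemma isPiSystem_dyadicIntervals : IsPiSystem dyadicIntervals := by
  rintro _ ⟨n, x, rfl⟩ _ ⟨m, y, rfl⟩ ⟨z, hzx, hzy⟩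
  refine ⟨max n m, z, ?_⟩
  ext w
  simp only [I, Set.mem_inter_iff, Set.mem_ofPred_eq, lt_max_iff] at *
  constructor
  · rintro ⟨h1, h2⟩ k (hk | hk)
    · rw [h1 k hk, hzx k hk]
    · rw [h2 k hk, hzy k hk]
  · intro h
    exact ⟨fun k hk => (h k (.inl hk)).trans (hzx k hk),
      fun k hk => (h k (.inr hk)).trans (hzy k hk)⟩

lemma generateFrom_dyadicIntervals :
    (inferInstance : MeasurableSpace G) = MeasurableSpace.generateFrom dyadicIntervals := by
  refine le_antisymm ?_ (MeasurableSpace.generateFrom_le ?_)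
  · refine iSup_le fun k => ?_
    rintro _ ⟨t, -, rfl⟩
    have hle : F (k + 1) ≤ MeasurableSpace.generateFrom dyadicIntervals :=
      MeasurableSpace.generateFrom_mono fun s ⟨x, hx⟩ => ⟨k + 1, x, hx⟩
    refine hle _ (measurableSet_of_saturated fun x hx y hy => ?_)
    simp only [Set.mem_preimage] at hx ⊢
    rwa [hy k (Nat.lt_succ_self k)]
  · rintro _ ⟨n, x, rfl⟩
    exact measurableSet_I n x

lemma measurable_add_e (n : ℕ) : Measurable fun x : G => x + e n := by
  refine measurable_pi_lambda _ fun k => ?_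
  have h : Measurable fun a : ZMod 2 => a + e n k := measurable_from_top
  exact h.comp (measurable_pi_apply k)

lemma add_e_add_e (n : ℕ) (x : G) : x + e n + e n = x := by
  funext k
  simp only [Pi.add_apply, add_assoc, CharTwo.add_self_eq_zero, add_zero]

lemma add_e_apply_of_ne {n k : ℕ} (h : k ≠ n) (x : G) : (x + e n) k = x k := by
  simp [e, h]

lemma add_e_apply_self (n : ℕ) (x : G) : (x + e n) n = x n + 1 := by
  simp [e]

/-- Flipping one coordinate preserves the Haar measure. -/
lemma measurePreserving_add_e (n : ℕ) : MeasurePreserving (fun x : G => x + e n) μG μG := by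
  refine ⟨measurable_add_e n, ?_⟩
  have : IsProbabilityMeasure (Measure.map (fun x : G => x + e n) μG) :=
    Measure.isProbabilityMeasure_map (measurable_add_e n).aemeasurable
  refine ext_of_generate_finite dyadicIntervals generateFrom_dyadicIntervals
    isPiSystem_dyadicIntervals ?_ (by simp)
  rintro _ ⟨m, x, rfl⟩
  rw [Measure.map_apply (measurable_add_e n) (measurableSet_I m x)]
  have h : (fun y : G => y + e n) ⁻¹' I m x = I m (x + e n) := by
    ext y
    simp only [I, Set.mem_preimage, Set.mem_ofPred_eq, Pi.add_apply]
    refine forall₂_congr fun k _ => ?_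
    rw [← CharTwo.sub_eq_add (x k), eq_sub_iff_add_eq]
  rw [h, measure_I, measure_I]

/-- A function of the coordinates below `n` is `𝔉_n`-measurable. -/
lemma stronglyMeasurable_of_dependsOn {n : ℕ} {f : G → ℝ} (hf : DependsOn f (Set.Iio n)) :
    StronglyMeasurable[F n] f := by
  refine Measurable.stronglyMeasurable (mα := F n) fun t _ => ?_
  refine measurableSet_of_saturated fun x hx y hy => ?_
  simp only [Set.mem_preimage] at hx ⊢
  rwa [hf fun k hk => hy k hk]

lemma integrable_of_dependsOn {n : ℕ} {f : G → ℝ} (hf : DependsOn f (Set.Iio n)) :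
    Integrable f μG := by
  classical
  let ext : (Fin n → ZMod 2) → G := fun z k => if h : k < n then z ⟨k, h⟩ else 0
  refine Integrable.of_bound
    ((stronglyMeasurable_of_dependsOn hf).mono (F_le n)).aestronglyMeasurable
    (∑ z, ‖f (ext z)‖) (ae_of_all _ fun x => ?_)
  have h : f x = f (ext fun i => x i) := hf fun k hk => by simp [ext, Set.mem_Iio.1 hk]
  rw [h]
  exact Finset.single_le_sum (f := fun z => ‖f (ext z)‖) (fun z _ => norm_nonneg _)
    (Finset.mem_univ fun i : Fin n => x i)

lemma apply_add_e_of_dependsOn {n : ℕ} {f : G → ℝ} (hf : DependsOn f (Set.Iio n)) (x : G) :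
    f (x + e n) = f x :=
  hf fun _ hk => add_e_apply_of_ne (ne_of_lt hk) x

lemma neg_one_pow_val_add_one (a : ZMod 2) : (-1 : ℝ) ^ (a + 1).val = -(-1 : ℝ) ^ a.val := by
  fin_cases a
  · change (-1 : ℝ) ^ 1 = -(-1 : ℝ) ^ 0
    norm_num
  · change (-1 : ℝ) ^ 0 = -(-1 : ℝ) ^ 1
    norm_num

lemma rademacher_add_e (n : ℕ) (x : G) : rademacher n (x + e n) = -rademacher n x := by
  rw [rademacher, add_e_apply_self, neg_one_pow_val_add_one, rademacher]

lemma abs_rademacher (n : ℕ) (x : G) : |rademacher n x| = 1 := by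
  simp [rademacher, abs_pow]

/-- Flipping the `n`-th coordinate, as a measurable equivalence. -/
def flipEquiv (n : ℕ) : G ≃ᵐ G where
  toFun x := x + e n
  invFun x := x + e n
  left_inv := add_e_add_e n
  right_inv := add_e_add_e n
  measurable_toFun := measurable_add_e n
  measurable_invFun := measurable_add_e n

lemma measurePreserving_flipEquiv (n : ℕ) : MeasurePreserving (flipEquiv n) μG μG :=
  measurePreserving_add_e n

lemma integral_eq_zero_of_odd {n : ℕ} {f : G → ℝ} (hf : ∀ x, f (x + e n) = -f x) :
    ∫ x, f x ∂μG = 0 := by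
  have h := (measurePreserving_flipEquiv n).integral_comp' (g := f)
  have h' : ∀ x, f (flipEquiv n x) = -f x := hf
  simp only [h', integral_neg] at h
  linarith

lemma measure_le_two_mul_of_flip {n : ℕ} {S U : Set G}
    (h : ∀ x ∈ S, x ∈ U ∨ x + e n ∈ U) : μG S ≤ 2 * μG U := by
  calc μG S ≤ μG (U ∪ flipEquiv n ⁻¹' U) := measure_mono h
    _ ≤ μG U + μG (flipEquiv n ⁻¹' U) := measure_union_le _ _
    _ = 2 * μG U := by
      rw [(measurePreserving_flipEquiv n).measure_preimage_equiv, two_mul]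

lemma order_two_pow_add {A i : ℕ} (hi : i < 2 ^ A) : order (2 ^ A + i) = A := by
  rw [order, Nat.log_eq_iff (by simp)]
  rw [pow_succ]
  omega

lemma order_lt_of_lt_two_pow {n i : ℕ} (h0 : i ≠ 0) (hi : i < 2 ^ n) : order i < n :=
  Nat.log_lt_of_lt_pow h0 hi

lemma dependsOn_rademacher {k n : ℕ} (h : k < n) : DependsOn (rademacher k) (Set.Iio n) := by
  intro x y hxy
  simp only [rademacher, hxy k h]

lemma dependsOn_kacz {n i : ℕ} (hi : i < 2 ^ n) : DependsOn (kacz i) (Set.Iio n) := by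
  intro x y hxy
  rcases eq_or_ne i 0 with rfl | h0
  · simp [kacz]
  have hn := order_lt_of_lt_two_pow h0 hi
  simp only [kacz, h0, if_false]
  rw [dependsOn_rademacher hn hxy]
  congr 2
  refine Finset.sum_congr rfl fun k _ => ?_
  rw [hxy (order i - 1 - k) (by rw [Set.mem_Iio]; omega)]

lemma kacz_add_e {i : ℕ} (h0 : i ≠ 0) (x : G) : kacz i (x + e (order i)) = -kacz i x := by
  simp only [kacz, h0, if_false, rademacher_add_e]
  rw [neg_mul]
  congr 3
  refine Finset.sum_congr rfl fun k hk => ?_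
  rw [add_e_apply_of_ne (by rw [Finset.mem_range] at hk; omega)]

lemma kacz_of_mem_I_zero {i : ℕ} (h0 : i ≠ 0) {x : G} (hx : x ∈ I (order i) 0) :
    kacz i x = rademacher (order i) x := by
  simp only [kacz, h0, if_false]
  rw [Finset.sum_eq_zero, pow_zero, mul_one]
  intro k hk
  rw [Finset.mem_range] at hk
  rw [hx (order i - 1 - k) (by omega)]
  simp

/-- The difference `D_{2^{A+1}} - D_{2^A} = r_A 2^A 1_{I_A}` of Dirichlet kernels. -/
def block (A : ℕ) (x : G) : ℝ := rademacher A x * (I A 0).indicator (fun _ => (2 : ℝ) ^ A) x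

lemma dependsOn_indicator_I (A : ℕ) (a : ℝ) :
    DependsOn ((I A 0).indicator fun _ => a) (Set.Iio A) := by
  classical
  intro x y hxy
  have h : x ∈ I A 0 ↔ y ∈ I A 0 := forall₂_congr fun k hk => by rw [hxy k hk]
  simp only [Set.indicator_apply, h]

lemma dependsOn_block (A : ℕ) : DependsOn (block A) (Set.Iio (A + 1)) := by
  intro x y hxy
  rw [block, block, dependsOn_rademacher A.lt_succ_self hxy,
    dependsOn_indicator_I A _ fun k hk => hxy k (lt_trans hk A.lt_succ_self)]

lemma block_add_e (A : ℕ) (x : G) : block A (x + e A) = -block A x := by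
  rw [block, rademacher_add_e, apply_add_e_of_dependsOn (dependsOn_indicator_I A _), block,
    neg_mul]

lemma integral_block_mul_kacz {i : ℕ} (h0 : i ≠ 0) (A : ℕ) :
    ∫ x, block A x * kacz i x ∂μG = if A = order i then 1 else 0 := by
  rcases lt_trichotomy A (order i) with h | rfl | h
  · rw [if_neg h.ne]
    refine integral_eq_zero_of_odd (n := order i) fun x => ?_
    have hb : block A (x + e (order i)) = block A x :=
      apply_add_e_of_dependsOn (fun x y hxy => dependsOn_block A fun k hk =>
        hxy k (Set.mem_Iio.2 (lt_of_lt_of_le hk h))) x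
    rw [kacz_add_e h0, hb, mul_neg]
  · rw [if_pos rfl]
    have hrw : ∀ x, block (order i) x * kacz i x =
        (I (order i) 0).indicator (fun _ => (2 : ℝ) ^ order i) x := by
      intro x
      by_cases hx : x ∈ I (order i) 0
      · have hsq := abs_mul_abs_self (rademacher (order i) x)
        rw [abs_rademacher] at hsq
        rw [kacz_of_mem_I_zero h0 hx, block, mul_right_comm, ← hsq, one_mul, one_mul]
      · simp [block, hx]
    simp only [hrw]
    rw [integral_indicator_const _ (measurableSet_I _ _), measureReal_def, measure_I]
    simp
  · rw [if_neg h.ne']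
    refine integral_eq_zero_of_odd (n := A) fun x => ?_
    have hi : i < 2 ^ A := Nat.lt_pow_of_log_lt one_lt_two h
    rw [block_add_e, apply_add_e_of_dependsOn (dependsOn_kacz hi), neg_mul]

/-- The martingale with Walsh–Kaczmarz coefficient `c A` at all indices of order `A`. -/
def lacunary (c : ℕ → ℝ) (n : ℕ) (x : G) : ℝ := ∑ A ∈ Finset.range n, c A * block A x

lemma dependsOn_lacunary (c : ℕ → ℝ) (n : ℕ) : DependsOn (lacunary c n) (Set.Iio n) := by
  intro x y hxy
  refine Finset.sum_congr rfl fun A hA => ?_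
  rw [dependsOn_block A fun k hk =>
    hxy k (Set.mem_Iio.2 (lt_of_lt_of_le hk (Finset.mem_range.1 hA)))]

lemma mem_add_e_iff_of_measurableSet {n : ℕ} {s : Set G} (hs : MeasurableSet[F n] s) :
    ∀ x, x + e n ∈ s ↔ x ∈ s := by
  induction s, hs using MeasurableSpace.generateFrom_induction with
  | hC t ht _ =>
    obtain ⟨y, rfl⟩ := ht
    exact fun x => forall₂_congr fun k hk => by rw [add_e_apply_of_ne hk.ne]
  | empty => simp
  | compl t _ ih => exact fun x => not_congr (ih x)
  | iUnion f _ ih =>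
    intro x
    simp only [Set.mem_iUnion]
    exact exists_congr fun i => ih i x

lemma isDyadicMartingale_lacunary (c : ℕ → ℝ) : IsDyadicMartingale (lacunary c) := by
  have hint n : Integrable (lacunary c n) μG := integrable_of_dependsOn (dependsOn_lacunary c n)
  have hmeas n : StronglyMeasurable[F n] (lacunary c n) :=
    stronglyMeasurable_of_dependsOn (dependsOn_lacunary c n)
  refine ⟨hint, hmeas, fun n => ?_⟩
  refine (ae_eq_condExp_of_forall_setIntegral_eq (F_le n) (hint (n + 1))
    (fun s _ _ => (hint n).integrableOn) (fun s hs _ => ?_)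
    (hmeas n).aestronglyMeasurable).symm
  have hblock : Integrable (fun x => c n * block n x) μG :=
    (integrable_of_dependsOn (dependsOn_block n)).const_mul _
  have hsucc : ∀ x, lacunary c (n + 1) x = lacunary c n x + c n * block n x := fun x => by
    rw [lacunary, Finset.sum_range_succ, lacunary]
  have hzero : ∫ x in s, c n * block n x ∂μG = 0 := by
    classical
    rw [← integral_indicator (F_le n s hs)]
    refine integral_eq_zero_of_odd (n := n) fun x => ?_
    simp only [Set.indicator_apply, mem_add_e_iff_of_measurableSet hs x, block_add_e]
    split_ifs <;> simp
  simp only [hsucc]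
  rw [integral_add (hint n).integrableOn hblock.integrableOn, hzero, add_zero]

lemma martCoeffK_lacunary (c : ℕ → ℝ) {i : ℕ} (h0 : i ≠ 0) :
    martCoeffK (lacunary c) i = c (order i) := by
  refine Tendsto.limUnder_eq (tendsto_const_nhds.congr' ?_)
  filter_upwards [eventually_gt_atTop (order i)] with k hk
  have hint A : Integrable (fun x => block A x * kacz i x) μG := by
    refine integrable_of_dependsOn (n := max (A + 1) i) fun x y hxy => ?_
    rw [dependsOn_block A fun k hk => hxy k (Set.mem_Iio.2 (lt_max_of_lt_left hk)),
      dependsOn_kacz i.lt_two_pow_self fun k hk => hxy k (Set.mem_Iio.2 (lt_max_of_lt_right hk))]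
  simp only [lacunary, Finset.sum_mul, mul_assoc]
  rw [integral_finsetSum _ fun A _ => (hint A).const_mul _]
  simp only [integral_const_mul, integral_block_mul_kacz h0]
  simp [hk]

lemma rpow_sum_le_sum_rpow {ι : Type*} (s : Finset ι) (f : ι → ℝ≥0∞) {p : ℝ} (hp0 : 0 < p)
    (hp1 : p ≤ 1) : (∑ i ∈ s, f i) ^ p ≤ ∑ i ∈ s, f i ^ p := by
  classical
  induction s using Finset.induction_on with
  | empty => simp [hp0]
  | insert a s ha ih =>
    rw [Finset.sum_insert ha, Finset.sum_insert ha]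
    exact (ENNReal.rpow_add_le_add_rpow _ _ hp0.le hp1).trans (by gcongr)

lemma martHpNormP_lacunary_le {p : ℝ} (hp0 : 0 < p) (hp1 : p ≤ 1) (c : ℕ → ℝ) :
    martHpNormP p (lacunary c) ≤
      ∑' A, ENNReal.ofReal (|c A| * 2 ^ A) ^ p * (2⁻¹ : ℝ≥0∞) ^ A := by
  have hpoint : ∀ x, (⨆ n, ENNReal.ofReal |lacunary c n x|) ^ p ≤
      ∑' A, (I A 0).indicator (fun _ => ENNReal.ofReal (|c A| * 2 ^ A) ^ p) x := by
    intro x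
    rw [← ENNReal.le_rpow_inv_iff hp0]
    refine iSup_le fun n => ?_
    rw [ENNReal.le_rpow_inv_iff hp0]
    have hterm : ∀ A, ENNReal.ofReal |c A * block A x| ^ p =
        (I A 0).indicator (fun _ => ENNReal.ofReal (|c A| * 2 ^ A) ^ p) x := by
      intro A
      by_cases hx : x ∈ I A 0
      · simp [block, hx, abs_mul, abs_rademacher]
      · simp [block, hx, hp0]
    calc ENNReal.ofReal |lacunary c n x| ^ p
        ≤ (∑ A ∈ Finset.range n, ENNReal.ofReal |c A * block A x|) ^ p := by
          rw [← ENNReal.ofReal_sum_of_nonneg fun _ _ => abs_nonneg _]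
          gcongr
          exact Finset.abs_sum_le_sum_abs _ _
      _ ≤ ∑ A ∈ Finset.range n, ENNReal.ofReal |c A * block A x| ^ p :=
          rpow_sum_le_sum_rpow _ _ hp0 hp1
      _ ≤ _ := by
          simp only [hterm]
          exact ENNReal.sum_le_tsum _
  calc martHpNormP p (lacunary c)
      ≤ ∫⁻ x, ∑' A, (I A 0).indicator (fun _ => ENNReal.ofReal (|c A| * 2 ^ A) ^ p) x ∂μG :=
        lintegral_mono hpoint
    _ = _ := by
        rw [lintegral_tsum fun A =>
          (measurable_const.indicator (measurableSet_I A 0)).aemeasurable]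
        refine tsum_congr fun A => ?_
        rw [lintegral_indicator_const (measurableSet_I A 0), measure_I]

/-- The formula for `κ_{2^A+i}` when `i < 2^A`, extended to all `i`. -/
def blockChar (A i : ℕ) (x : G) : ℝ :=
  rademacher A x * (-1 : ℝ) ^ (∑ k ∈ Finset.range A,
    (if i.testBit k then (x (A - 1 - k)).val else 0))

lemma kacz_two_pow_add {A i : ℕ} (hi : i < 2 ^ A) (x : G) :
    kacz (2 ^ A + i) x = blockChar A i x := by
  rw [kacz, if_neg (by positivity), order_two_pow_add hi, blockChar]
  congr 2
  refine Finset.sum_congr rfl fun k hk => ?_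
  rw [Nat.testBit_two_pow_add_gt (Finset.mem_range.1 hk)]

lemma abs_blockChar (A i : ℕ) (x : G) : |blockChar A i x| = 1 := by
  simp [blockChar, abs_mul, abs_rademacher, abs_pow]

lemma blockChar_add_e (A i : ℕ) (x : G) : blockChar A i (x + e A) = -blockChar A i x := by
  rw [blockChar, rademacher_add_e, blockChar, neg_mul]
  congr 3
  refine Finset.sum_congr rfl fun k hk => ?_
  rw [add_e_apply_of_ne (by rw [Finset.mem_range] at hk; omega)]

lemma blockChar_four_mul_add (B q : ℕ) {b : ℕ} (hb : b < 4) {x : G} (h1 : x (B + 1) = 1)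
    (h2 : x B = 1) : blockChar (B + 2) (4 * q + b) x =
      blockChar (B + 2) (4 * q) x *
        (-1 : ℝ) ^ ((if b.testBit 0 then 1 else 0) + (if b.testBit 1 then 1 else 0)) := by
  have hbit : ∀ r < 4, ∀ k, (4 * q + r).testBit (k + 2) = q.testBit k := fun r hr k => by
    rw [show k + 2 = 2 + k by ring, ← Nat.testBit_shiftRight, Nat.shiftRight_eq_div_pow]
    congr 1
    omega
  have hbit1 : (4 * q + b).testBit 1 = b.testBit 1 := by
    simp only [Nat.testBit_eq_decide_div_mod_eq]
    congr 2
    omega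
  have hbit0 : (4 * q + b).testBit 0 = b.testBit 0 := by
    simp only [Nat.testBit_eq_decide_div_mod_eq]
    congr 2
    omega
  have hz1 : (4 * q).testBit 1 = false := by
    simp only [Nat.testBit_eq_decide_div_mod_eq, decide_eq_false_iff_not]
    omega
  have hz0 : (4 * q).testBit 0 = false := by
    simp only [Nat.testBit_eq_decide_div_mod_eq, decide_eq_false_iff_not]
    omega
  have hz : ∀ k, (4 * q).testBit (k + 2) = q.testBit k := hbit 0 (by norm_num)
  have hone : (1 : ZMod 2).val = 1 := rfl
  simp only [blockChar, Finset.sum_range_succ', zero_add, add_assoc, Nat.reduceAdd,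
    hbit b hb, hz, hbit1, hbit0, hz1, hz0]
  rw [show B + 2 - 1 - 1 = B by omega, show B + 2 - 1 - 0 = B + 1 by omega, h1, h2, hone]
  simp only [Bool.false_eq_true, if_false, add_zero]
  rw [mul_assoc, ← pow_add]
  congr 2
  omega

lemma sum_four_periodic {a : ℕ → ℝ} (h1 : ∀ q, a (4 * q + 1) = -a (4 * q))
    (h2 : ∀ q, a (4 * q + 2) = -a (4 * q)) (h3 : ∀ q, a (4 * q + 3) = a (4 * q)) (q : ℕ) :
    ∑ i ∈ Finset.range (4 * q), a i = 0 ∧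
      ∑ l ∈ Finset.range (4 * q + 2), ∑ i ∈ Finset.range l, a i = a (4 * q) := by
  induction q with
  | zero => simp [Finset.sum_range_succ]
  | succ q ih =>
    obtain ⟨ih1, ih2⟩ := ih
    have hsum : ∑ i ∈ Finset.range (4 * (q + 1)), a i = 0 := by
      rw [show 4 * (q + 1) = 4 * q + 3 + 1 by ring]
      simp only [Finset.sum_range_succ, ih1, h1, h2, h3]
      ring
    refine ⟨hsum, ?_⟩
    rw [Finset.sum_range_succ, Finset.sum_range_succ _ (4 * (q + 1)), hsum,
      Finset.sum_range_succ, hsum, show 4 * (q + 1) = 4 * q + 2 + 1 + 1 by ring,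
      Finset.sum_range_succ _ (4 * q + 2 + 1), Finset.sum_range_succ _ (4 * q + 2), ih2]
    simp only [Finset.sum_range_succ, ih1, h1, h2]
    ring

/-- The sum `∑_{l ≤ 4q+1} ∑_{i < l} κ_{2^A+i}`. -/
def blockFejer (A q : ℕ) (x : G) : ℝ :=
  ∑ l ∈ Finset.range (4 * q + 2), ∑ i ∈ Finset.range l, blockChar A i x

lemma blockFejer_add_e (A q : ℕ) (x : G) : blockFejer A q (x + e A) = -blockFejer A q x := by
  simp only [blockFejer, blockChar_add_e, Finset.sum_neg_distrib]

lemma abs_blockFejer (B q : ℕ) {x : G} (h1 : x (B + 1) = 1) (h2 : x B = 1) :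
    |blockFejer (B + 2) q x| = 1 := by
  rw [blockFejer, (sum_four_periodic (a := fun i => blockChar (B + 2) i x) ?_ ?_ ?_ q).2,
    abs_blockChar]
  · intro q
    rw [blockChar_four_mul_add B q (b := 1) (by norm_num) h1 h2]
    simp [Nat.testBit_eq_decide_div_mod_eq]
  · intro q
    rw [blockChar_four_mul_add B q (b := 2) (by norm_num) h1 h2]
    simp [Nat.testBit_eq_decide_div_mod_eq]
  · intro q
    rw [blockChar_four_mul_add B q (b := 3) (by norm_num) h1 h2]
    simp [Nat.testBit_eq_decide_div_mod_eq]

lemma dependsOn_martSK {f : ℕ → G → ℝ} {j A : ℕ} (hj : j ≤ 2 ^ A) :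
    DependsOn (martSK f j) (Set.Iio A) := by
  intro x y hxy
  refine Finset.sum_congr rfl fun k hk => ?_
  rw [dependsOn_kacz ((Finset.mem_range.1 hk).trans_le hj) hxy]

lemma exists_sum_martSK_lacunary_eq (c : ℕ → ℝ) {A q : ℕ} (hq : 4 * q + 1 ≤ 2 ^ A) :
    ∃ P : G → ℝ, (∀ x, P (x + e A) = P x) ∧ ∀ x,
      ∑ j ∈ Finset.range (2 ^ A + 4 * q + 1 + 1), martSK (lacunary c) j x =
        P x + c A * blockFejer A q x := by
  refine ⟨fun x => ∑ j ∈ Finset.range (2 ^ A), martSK (lacunary c) j x +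
    (4 * q + 2) * martSK (lacunary c) (2 ^ A) x, fun x => ?_, fun x => ?_⟩
  · have h : ∀ j ≤ 2 ^ A,
        martSK (lacunary c) j (x + e A) = martSK (lacunary c) j x := fun j hj =>
      apply_add_e_of_dependsOn (dependsOn_martSK hj) x
    simp only [h _ le_rfl]
    rw [Finset.sum_congr rfl fun j hj => h j (Finset.mem_range.1 hj).le]
  · have h : ∀ l ∈ Finset.range (4 * q + 2), martSK (lacunary c) (2 ^ A + l) x =
        martSK (lacunary c) (2 ^ A) x + c A * ∑ i ∈ Finset.range l, blockChar A i x := by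
      intro l hl
      rw [martSK, Finset.sum_range_add, Finset.mul_sum]
      refine congrArg₂ _ rfl (Finset.sum_congr rfl fun i hi => ?_)
      have hi' : i < 2 ^ A := by
        rw [Finset.mem_range] at hi hl
        omega
      rw [martCoeffK_lacunary c (by positivity), order_two_pow_add hi', kacz_two_pow_add hi']
    rw [show 2 ^ A + 4 * q + 1 + 1 = 2 ^ A + (4 * q + 2) by ring, Finset.sum_range_add,
      Finset.sum_congr rfl h, Finset.sum_add_distrib, ← Finset.mul_sum, blockFejer]
    simp
    ring

lemma one_eighth_le_measure_martSigmaK {c : ℕ → ℝ} {B q : ℕ} (hc : 0 < c (B + 2))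
    (hq : 4 * q + 1 ≤ 2 ^ (B + 2)) :
    1 / 8 ≤ μG {x | c (B + 2) / 2 ^ (B + 4) <
      |martSigmaK (lacunary c) (2 ^ (B + 2) + 4 * q + 1) x|} := by
  obtain ⟨P, hP, hsum⟩ := exists_sum_martSK_lacunary_eq c hq
  set m : ℕ := 2 ^ (B + 2) + 4 * q + 1 with hm
  set U : Set G := {x | c (B + 2) / 2 ^ (B + 4) < |martSigmaK (lacunary c) m x|} with hU
  have hmpos : (0 : ℝ) < m := by positivity
  have hmle : (m : ℝ) < 2 ^ (B + 4) := by
    have h : m < 2 ^ (B + 4) := by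
      have h' : (2 : ℕ) ^ (B + 4) = 4 * 2 ^ (B + 2) := by ring
      omega
    exact_mod_cast h
  have hmem : ∀ x, c (B + 2) ≤ |P x + c (B + 2) * blockFejer (B + 2) q x| → x ∈ U := by
    intro x hx
    change _ < |martSigmaK (lacunary c) m x|
    rw [martSigmaK, hsum, abs_mul, abs_of_pos (one_div_pos.2 hmpos), one_div_mul_eq_div]
    calc c (B + 2) / 2 ^ (B + 4) < c (B + 2) / m := by gcongr
      _ ≤ _ := by gcongr
  have h1 : μG Set.univ ≤ 2 * μG {x : G | x B = 1} := by
    refine measure_le_two_mul_of_flip (n := B) fun x _ => ?_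
    simp only [Set.mem_ofPred_eq, add_e_apply_self]
    generalize x B = a
    revert a
    decide
  have h2 : μG {x : G | x B = 1} ≤ 2 * μG {x : G | x (B + 1) = 1 ∧ x B = 1} := by
    refine measure_le_two_mul_of_flip (n := B + 1) fun x hx => ?_
    have hxB : x B = 1 := hx
    simp only [Set.mem_ofPred_eq, add_e_apply_self, add_e_apply_of_ne B.lt_succ_self.ne, hxB]
    generalize x (B + 1) = a
    revert a
    decide
  have h3 : μG {x : G | x (B + 1) = 1 ∧ x B = 1} ≤ 2 * μG U := by
    refine measure_le_two_mul_of_flip (n := B + 2) fun x ⟨hx1, hx2⟩ => ?_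
    by_contra! hcon
    have hlt1 := lt_of_not_ge fun h => hcon.1 (hmem x h)
    have hlt2 := lt_of_not_ge fun h => hcon.2 (hmem (x + e (B + 2)) h)
    rw [hP, blockFejer_add_e] at hlt2
    have habs := abs_blockFejer B q hx1 hx2
    rw [abs_lt] at hlt1 hlt2
    rcases eq_or_eq_neg_of_abs_eq habs with h | h <;> rw [h] at hlt1 hlt2 <;> linarith
  rw [measure_univ] at h1
  have h4 : (1 : ℝ≥0∞) ≤ μG U * 8 := by
    calc (1 : ℝ≥0∞) ≤ 2 * (2 * (2 * μG U)) := h1.trans (by gcongr; exact h2.trans (by gcongr))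
      _ = μG U * 8 := by ring
  exact ENNReal.div_le_of_le_mul h4

lemma le_weakLpNorm_martSigmaK {p : ℝ} (hp0 : 0 < p) {c : ℕ → ℝ} {B q : ℕ}
    (hc : 0 < c (B + 2)) (hq : 4 * q + 1 ≤ 2 ^ (B + 2)) :
    ENNReal.ofReal ((c (B + 2) / 2 ^ (B + 4)) ^ p / 8) ≤
      weakLpNorm p (martSigmaK (lacunary c) (2 ^ (B + 2) + 4 * q + 1)) ^ p := by
  have ht : 0 < c (B + 2) / 2 ^ (B + 4) := by positivity
  have hle : ENNReal.ofReal (c (B + 2) / 2 ^ (B + 4)) * (1 / 8 : ℝ≥0∞) ^ (1 / p) ≤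
      weakLpNorm p (martSigmaK (lacunary c) (2 ^ (B + 2) + 4 * q + 1)) := by
    refine le_trans ?_ (le_iSup₂ (f := fun (t : ℝ) (_ : 0 < t) => ENNReal.ofReal t *
      μG {x : G | t < |martSigmaK (lacunary c) (2 ^ (B + 2) + 4 * q + 1) x|} ^ (1 / p)) _ ht)
    gcongr
    exact one_eighth_le_measure_martSigmaK hc hq
  calc ENNReal.ofReal ((c (B + 2) / 2 ^ (B + 4)) ^ p / 8)
      = (ENNReal.ofReal (c (B + 2) / 2 ^ (B + 4)) * (1 / 8 : ℝ≥0∞) ^ (1 / p)) ^ p := by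
        rw [ENNReal.mul_rpow_of_nonneg _ _ hp0.le, ← ENNReal.rpow_mul,
          one_div_mul_cancel hp0.ne', ENNReal.rpow_one, ENNReal.ofReal_rpow_of_pos ht,
          ENNReal.ofReal_div_of_pos (by norm_num), ENNReal.ofReal_ofNat, mul_one_div]
    _ ≤ _ := by gcongr

lemma exists_summable_one_le_mul {v : ℕ → ℝ} (hv : ∀ K : ℝ, ∃ᶠ A in atTop, K < v A) :
    ∃ u : ℕ → ℝ, (∀ A, 0 ≤ u A) ∧ Summable u ∧ ∃ᶠ A in atTop, 0 < u A ∧ 1 ≤ u A * v A := by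
  classical
  obtain ⟨φ, hφ, hvφ⟩ := extraction_forall_of_frequently fun k : ℕ => hv (2 ^ k)
  have hpos : ∀ k, 0 < v (φ k) := fun k => lt_trans (by positivity) (hvφ k)
  refine ⟨(Set.range φ).indicator fun A => (v A)⁻¹, ?_, ?_, ?_⟩
  · refine Set.indicator_nonneg ?_
    rintro _ ⟨k, rfl⟩
    exact (inv_pos.2 (hpos k)).le
  · rw [← hφ.injective.summable_iff fun A hA => Set.indicator_of_notMem hA _]
    refine Summable.of_nonneg_of_le (fun k => ?_) (fun k => ?_) summable_geometric_two
    · simp [(hpos k).le]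
    · simp only [Function.comp_apply, Set.mem_range_self, Set.indicator_of_mem, one_div, inv_pow]
      exact inv_anti₀ (by positivity) (hvφ k).le
  · refine hφ.tendsto_atTop.frequently (Frequently.of_forall fun k => ?_)
    simp [(hpos k).ne', hpos k, inv_mul_cancel₀]

/-- Sharpness of the strong convergence theorem for `0 < p < 1/2`: for any
non-decreasing `Φ : ℕ₊ → [1,∞)` with `Φ(n) ↑ ∞` and
`limsup_k 2^{k(2-2p)}/Φ(2^k) = ∞`, there is a martingale `F ∈ H_p(G)` with
`∑_{m=1}^∞ ‖σ_m^κ F‖_{L_{p,∞}}^p / Φ(m) = ∞`. -/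
theorem sharpness (p : ℝ) (hp0 : 0 < p) (hp : p < 1/2) (Φ : ℕ → ℝ)
    (hΦ1 : ∀ n, 1 ≤ n → 1 ≤ Φ n)
    (hΦmono : ∀ m n, 1 ≤ m → m ≤ n → Φ m ≤ Φ n)
    (hΦtop : Tendsto Φ atTop atTop)
    (hlimsup : Filter.limsup
        (fun k : ℕ => ENNReal.ofReal ((2 : ℝ) ^ ((k : ℝ) * (2 - 2 * p)) / Φ (2 ^ k)))
        atTop = ∞) :
    ∃ F : ℕ → G → ℝ, MemHp p F ∧
      (∑' m : ℕ, weakLpNorm p (martSigmaK F (m + 1)) ^ p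
          / ENNReal.ofReal (Φ (m + 1))) = ∞ := by
  have hone : ∀ k : ℕ, 1 ≤ Φ (2 ^ k) := fun k => hΦ1 _ Nat.one_le_two_pow
  have hfreq : ∀ K : ℝ, ∃ᶠ A : ℕ in atTop,
      K < (2 : ℝ) ^ (((A + 1 : ℕ) : ℝ) * (2 - 2 * p)) / Φ (2 ^ (A + 1)) := by
    intro K
    have h := frequently_lt_of_lt_limsup (h := hlimsup ▸ ENNReal.ofReal_lt_top (r := K))
    rw [frequently_atTop] at h ⊢
    intro a
    obtain ⟨b, hb, hlt⟩ := h (a + 1)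
    obtain ⟨A, rfl⟩ := Nat.exists_eq_add_of_le' (le_of_add_le_right hb)
    exact ⟨A, by omega, (ENNReal.ofReal_lt_ofReal_iff'.1 hlt).1⟩
  obtain ⟨u, hu0, husum, hufreq⟩ := exists_summable_one_le_mul hfreq
  set c : ℕ → ℝ := fun A => (u A * (2 : ℝ) ^ ((A : ℝ) * (1 - p))) ^ (1 / p) with hc
  have hcp : ∀ A, c A ^ p = u A * (2 : ℝ) ^ ((A : ℝ) * (1 - p)) := fun A => by
    rw [hc, ← Real.rpow_mul (mul_nonneg (hu0 A) (by positivity)), one_div_mul_cancel hp0.ne',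
      Real.rpow_one]
  have hc0 : ∀ A, 0 ≤ c A := fun A =>
    Real.rpow_nonneg (mul_nonneg (hu0 A) (by positivity)) _
  refine ⟨lacunary c, ⟨isDyadicMartingale_lacunary c, ?_⟩, ?_⟩
  · refine (martHpNormP_lacunary_le hp0 (by linarith) c).trans_lt ?_
    have hterm : ∀ A : ℕ, ENNReal.ofReal (|c A| * 2 ^ A) ^ p * (2⁻¹ : ℝ≥0∞) ^ A =
        ENNReal.ofReal (u A) := by
      intro A
      have h2 : (2⁻¹ : ℝ≥0∞) ^ A = ENNReal.ofReal ((2 : ℝ) ^ (-(A : ℝ))) := by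
        rw [Real.rpow_neg (by norm_num), ENNReal.ofReal_inv_of_pos (by positivity),
          Real.rpow_natCast, ENNReal.ofReal_pow (by norm_num), ENNReal.ofReal_ofNat,
          ENNReal.inv_pow]
      rw [h2, abs_of_nonneg (hc0 A), ENNReal.ofReal_rpow_of_nonneg
        (mul_nonneg (hc0 A) (by positivity)) hp0.le, ← ENNReal.ofReal_mul
        (Real.rpow_nonneg (mul_nonneg (hc0 A) (by positivity)) _),
        Real.mul_rpow (hc0 A) (by positivity), hcp, ← Real.rpow_natCast 2 A,
        ← Real.rpow_mul (by norm_num), mul_assoc, mul_assoc, ← Real.rpow_add (by norm_num),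
        ← Real.rpow_add (by norm_num)]
      rw [show (A : ℝ) * (1 - p) + (A * p + -A) = 0 by ring, Real.rpow_zero, mul_one]
    simp only [hterm]
    rw [← ENNReal.ofReal_tsum_of_nonneg hu0 husum]
    exact ENNReal.ofReal_lt_top
  · by_contra hfin
    set f : ℕ → ℝ≥0∞ := fun m => weakLpNorm p (martSigmaK (lacunary c) (m + 1)) ^ p
      / ENNReal.ofReal (Φ (m + 1)) with hf
    have htail : Tendsto (fun A : ℕ => ∑' k, f (k + 2 ^ A)) atTop (nhds 0) :=
      (ENNReal.tendsto_sum_nat_add f hfin).comp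
        (tendsto_pow_atTop_atTop_of_one_lt one_lt_two)
    have hsmall : ∀ᶠ A in atTop, ∑' k, f (k + 2 ^ A) < ENNReal.ofReal (1 / 128) :=
      htail.eventually_lt_const (by simp)
    obtain ⟨A, ⟨⟨huA, huv⟩, hA2⟩, hlt⟩ :=
      ((hufreq.and_eventually (eventually_ge_atTop 2)).and_eventually hsmall).exists
    obtain ⟨B, rfl⟩ := Nat.exists_eq_add_of_le' hA2
    refine hlt.not_ge ?_
    have hcpos : 0 < c (B + 2) := Real.rpow_pos_of_pos (mul_pos huA (by positivity)) _
    set w : ℝ := (c (B + 2) / 2 ^ (B + 4)) ^ p / 8 / Φ (2 ^ (B + 3)) with hw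
    have hΦpos : 0 < Φ (2 ^ (B + 3)) := one_pos.trans_le (hone _)
    have hterm : ∀ q ∈ Finset.range (2 ^ B), ENNReal.ofReal w ≤ f (4 * q + 2 ^ (B + 2)) := by
      intro q hq
      rw [Finset.mem_range] at hq
      have hq' : 4 * q + 1 ≤ 2 ^ (B + 2) := by
        rw [pow_add]
        omega
      have hpow : (2 : ℕ) ^ (B + 3) = 2 * 2 ^ (B + 2) := by ring
      rw [hw, ENNReal.ofReal_div_of_pos hΦpos, hf]
      refine ENNReal.div_le_div ?_ (ENNReal.ofReal_le_ofReal (hΦmono _ _ (by omega) (by omega)))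
      rw [add_comm (4 * q)]
      exact le_weakLpNorm_martSigmaK hp0 hcpos hq'
    have hvalue : 1 / 128 ≤ (2 : ℝ) ^ B * w := by
      have hpow : (2 : ℝ) ^ B * w = u (B + 2) *
          ((2 : ℝ) ^ (((B + 2 + 1 : ℕ) : ℝ) * (2 - 2 * p)) / Φ (2 ^ (B + 2 + 1))) *
            (1 / 128) := by
        rw [hw, Real.div_rpow hcpos.le (by positivity), hcp, ← Real.rpow_natCast 2 B,
          ← Real.rpow_natCast 2 (B + 4), ← Real.rpow_mul (by norm_num),
          show (8 : ℝ) = 2 ^ (3 : ℝ) by norm_num, show (128 : ℝ) = 2 ^ (7 : ℝ) by norm_num]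
        have hexp : (2 : ℝ) ^ (B : ℝ) * (2 : ℝ) ^ (((B + 2 : ℕ) : ℝ) * (1 - p)) =
            (2 : ℝ) ^ (((B + 2 + 1 : ℕ) : ℝ) * (2 - 2 * p)) *
              (2 : ℝ) ^ (((B + 4 : ℕ) : ℝ) * p) * (2 : ℝ) ^ (3 : ℝ) / (2 : ℝ) ^ (7 : ℝ) := by
          rw [← Real.rpow_add (by norm_num), ← Real.rpow_add (by norm_num),
            ← Real.rpow_add (by norm_num), ← Real.rpow_sub (by norm_num)]
          congr 1
          push_cast
          ring
        calc _ = u (B + 2) * ((2 : ℝ) ^ (B : ℝ) * (2 : ℝ) ^ (((B + 2 : ℕ) : ℝ) * (1 - p))) /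
              (2 : ℝ) ^ (((B + 4 : ℕ) : ℝ) * p) / (2 : ℝ) ^ (3 : ℝ) / Φ (2 ^ (B + 3)) := by ring
          _ = _ := by
            rw [hexp, show B + 2 + 1 = B + 3 by ring]
            field_simp
      rw [hpow]
      linarith
    calc ENNReal.ofReal (1 / 128) ≤ ENNReal.ofReal ((2 : ℝ) ^ B * w) :=
          ENNReal.ofReal_le_ofReal hvalue
      _ = ∑ q ∈ Finset.range (2 ^ B), ENNReal.ofReal w := by
          rw [ENNReal.ofReal_mul (by positivity), ENNReal.ofReal_pow (by norm_num)]
          simp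
      _ ≤ ∑ q ∈ Finset.range (2 ^ B), f (4 * q + 2 ^ (B + 2)) := Finset.sum_le_sum hterm
      _ ≤ ∑' q, f (4 * q + 2 ^ (B + 2)) := ENNReal.sum_le_tsum _
      _ ≤ ∑' k, f (k + 2 ^ (B + 2)) :=
          ENNReal.tsum_comp_le_tsum_of_injective (f := fun q : ℕ => 4 * q)
            (fun a b h => by simpa using h) fun k => f (k + 2 ^ (B + 2))

end WalshKaczmarz
end
end

section
/- Let A, t ∈ ℕ with A > t. If x ∈ I_t \ I_{t+1}, then K_{2^A}^w(x) = 0 when x − x_t e_t ∉ I_A, and K_{2^A}^w(x) = 2^{t−1} when x − x_t e_t ∈ I_A. Moreover, if x ∈ I_A then K_{2^A}^w(x) = (2^A + 1)/2. -/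
open MeasureTheory Filter
open scoped ENNReal

noncomputable section

namespace WalshKaczmarz

open scoped Classical

/-- The product defining `walsh n` may be taken over any range containing all binary digits
of `n`. -/
lemma walsh_eq_prod_range {n m : ℕ} (hn : n < 2 ^ m) (x : G) :
    walsh n x = ∏ k ∈ Finset.range m, (if n.testBit k then rademacher k x else 1) := by
  have extend : ∀ a b, a ≤ b → n < 2 ^ a →
      ∏ k ∈ Finset.range a, (if n.testBit k then rademacher k x else 1) =
        ∏ k ∈ Finset.range b, (if n.testBit k then rademacher k x else 1) := by
    intro a b hab hna
    refine Finset.prod_subset (Finset.range_mono hab) fun k _ hk => ?_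
    have hak : a ≤ k := by simpa using hk
    rw [Nat.testBit_lt_two_pow (hna.trans_le (Nat.pow_le_pow_right two_pos hak))]
    simp
  rw [walsh]
  rcases le_total n m with hnm | hmn
  · exact extend n m hnm Nat.lt_two_pow_self
  · exact (extend m n hmn hn).symm

lemma walsh_two_pow_add {A j : ℕ} (hj : j < 2 ^ A) (x : G) :
    walsh (2 ^ A + j) x = rademacher A x * walsh j x := by
  rw [walsh_eq_prod_range (m := A + 1) (by rw [pow_succ]; lia), walsh_eq_prod_range hj,
    Finset.prod_range_succ, mul_comm, Nat.testBit_two_pow_add_eq, Nat.testBit_lt_two_pow hj]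
  congr 1
  refine Finset.prod_congr rfl fun k hk => ?_
  rw [Nat.testBit_two_pow_add_gt (Finset.mem_range.mp hk)]

lemma dirW_two_pow_add {A j : ℕ} (hj : j ≤ 2 ^ A) (x : G) :
    dirW (2 ^ A + j) x = dirW (2 ^ A) x + rademacher A x * dirW j x := by
  simp only [dirW, Finset.sum_range_add, Finset.mul_sum]
  congr 1
  exact Finset.sum_congr rfl fun k hk =>
    walsh_two_pow_add ((Finset.mem_range.mp hk).trans_le hj) x

lemma dirW_two_pow_succ (A : ℕ) (x : G) :
    dirW (2 ^ (A + 1)) x = (1 + rademacher A x) * dirW (2 ^ A) x := by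
  rw [pow_succ, mul_two, dirW_two_pow_add le_rfl]
  ring

lemma sum_dirW_two_pow_succ (A : ℕ) (x : G) :
    ∑ k ∈ Finset.range (2 ^ (A + 1) + 1), dirW k x =
      (1 + rademacher A x) * ∑ k ∈ Finset.range (2 ^ A + 1), dirW k x +
        2 ^ A * dirW (2 ^ A) x := by
  have shifted : ∑ j ∈ Finset.range (2 ^ A + 1), dirW (2 ^ A + j) x =
      (2 ^ A + 1) * dirW (2 ^ A) x +
        rademacher A x * ∑ j ∈ Finset.range (2 ^ A + 1), dirW j x := by
    rw [Finset.sum_congr rfl fun j hj =>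
      dirW_two_pow_add (Nat.lt_succ_iff.mp (Finset.mem_range.mp hj)) x,
      Finset.sum_add_distrib, Finset.mul_sum]
    simp
  rw [show 2 ^ (A + 1) + 1 = 2 ^ A + (2 ^ A + 1) by ring, Finset.sum_range_add, shifted,
    Finset.sum_range_succ _ (2 ^ A)]
  ring

lemma rademacher_eq_one {k : ℕ} {x : G} (hk : x k = 0) : rademacher k x = 1 := by
  simp [rademacher, hk]

lemma rademacher_eq_neg_one {k : ℕ} {x : G} (hk : x k ≠ 0) : rademacher k x = -1 := by
  have hx : x k = 1 := by
    generalize x k = a at hk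
    revert a
    decide
  rw [rademacher, hx, ZMod.val_one, pow_one]

lemma mem_I_zero {n : ℕ} {x : G} : x ∈ I n 0 ↔ ∀ k < n, x k = 0 := Iff.rfl

lemma dirW_two_pow_of_mem {A : ℕ} {x : G} (hx : x ∈ I A 0) : dirW (2 ^ A) x = 2 ^ A := by
  induction A with
  | zero => simp [dirW, walsh]
  | succ n ih =>
    rw [dirW_two_pow_succ, rademacher_eq_one (hx n n.lt_succ_self),
      ih fun k hk => hx k (hk.trans n.lt_succ_self)]
    ring

lemma dirW_two_pow_of_ne_zero {A t : ℕ} (h : t < A) {x : G} (ht : x t ≠ 0) :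
    dirW (2 ^ A) x = 0 := by
  induction A, h using Nat.le_induction with
  | base => rw [dirW_two_pow_succ, rademacher_eq_neg_one ht]; ring
  | succ n _ ih => rw [dirW_two_pow_succ, ih, mul_zero]

lemma sum_dirW_of_mem {A : ℕ} {x : G} (hx : x ∈ I A 0) :
    ∑ k ∈ Finset.range (2 ^ A + 1), dirW k x = 2 ^ A * ((2 ^ A + 1) / 2) := by
  induction A with
  | zero => simp [dirW, walsh, Finset.sum_range_succ]
  | succ n ih =>
    have hn : x ∈ I n 0 := fun k hk => hx k (hk.trans n.lt_succ_self)
    rw [sum_dirW_two_pow_succ, rademacher_eq_one (hx n n.lt_succ_self), ih hn,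
      dirW_two_pow_of_mem hn]
    ring

lemma sum_dirW_of_first_ne_zero {A t : ℕ} (h : t < A) {x : G} (hx : x ∈ I t 0)
    (ht : x t ≠ 0) :
    ∑ k ∈ Finset.range (2 ^ A + 1), dirW k x =
      2 ^ A * if ∀ k < A, k ≠ t → x k = 0 then (2 : ℝ) ^ ((t : ℤ) - 1) else 0 := by
  induction A, h using Nat.le_induction with
  | base =>
    have hzero : ∀ k < t + 1, k ≠ t → x k = 0 := fun k hk hkt => hx k (by lia)
    rw [Nat.succ_eq_add_one, sum_dirW_two_pow_succ, rademacher_eq_neg_one ht,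
      dirW_two_pow_of_mem hx, if_pos hzero, zpow_sub₀ two_ne_zero, zpow_natCast, zpow_one]
    ring
  | succ n hn ih =>
    rw [sum_dirW_two_pow_succ, ih, dirW_two_pow_of_ne_zero hn ht]
    by_cases hxn : x n = 0
    · have hiff : (∀ k < n + 1, k ≠ t → x k = 0) ↔ ∀ k < n, k ≠ t → x k = 0 := by
        refine ⟨fun H k hk => H k (by lia), fun H k hk hkt => ?_⟩
        rcases Nat.lt_succ_iff_lt_or_eq.mp hk with hk | rfl
        exacts [H k hk hkt, hxn]
      rw [rademacher_eq_one hxn]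
      simp only [hiff]
      ring
    · have hne : ¬∀ k < n + 1, k ≠ t → x k = 0 :=
        fun H => hxn (H n n.lt_succ_self (by lia))
      rw [rademacher_eq_neg_one hxn, if_neg hne]
      ring

lemma sub_smul_e_mem_I_zero {A t : ℕ} {x : G} :
    x - (x t) • e t ∈ I A 0 ↔ ∀ k < A, k ≠ t → x k = 0 := by
  rw [mem_I_zero]
  refine forall₂_congr fun k _ => ?_
  by_cases hkt : k = t
  · subst hkt; simp [e]
  · simp [e, hkt]

/-- Gát's lemma on Walsh–Paley Fejér kernels `K_{2^A}^w`: for `A > t` and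
`x ∈ I_t \ I_{t+1}`, `K_{2^A}^w(x) = 2^{t-1}` if `x - x_t e_t ∈ I_A` and `= 0`
otherwise; moreover `K_{2^A}^w(x) = (2^A+1)/2` for `x ∈ I_A`. -/
theorem gat_fejer_kernel (A t : ℕ) (h : t < A) (x : G) :
    (x ∈ I t 0 \ I (t + 1) 0 →
      fejW (2 ^ A) x =
        if x - (x t) • e t ∈ I A 0 then (2 : ℝ) ^ ((t : ℤ) - 1) else 0) ∧
    (x ∈ I A 0 → fejW (2 ^ A) x = ((2 : ℝ) ^ A + 1) / 2) := by
  have cancel (s : ℝ) : 1 / ((2 ^ A : ℕ) : ℝ) * (2 ^ A * s) = s := by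
    push_cast
    field_simp
  refine ⟨fun ⟨hx, hx'⟩ => ?_, fun hx => ?_⟩
  · have ht : x t ≠ 0 := by
      intro ht
      refine hx' fun k hk => ?_
      rcases Nat.lt_succ_iff_lt_or_eq.mp hk with hk | rfl
      exacts [hx k hk, ht]
    rw [fejW, sum_dirW_of_first_ne_zero h hx ht, cancel]
    simp only [sub_smul_e_mem_I_zero]
  · rw [fejW, sum_dirW_of_mem hx, cancel]

end WalshKaczmarz
end
end
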